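/- Fix a constant λ ≥ 1 and set τ = 1/2 (balanced communities, n even). Consider the sequence of geometric block models G_n(r_s(n), r_d(n)) with r_s(n) = λ·r_d(n), 0 < r_s(n) ≤ 1/4, and n·r_s(n) → ∞. Define f(λ) = 3λ/(1+λ)² for λ ∈ [1,2), and f(λ) = 3(4+λ²)/(4(1+λ)²) for λ ≥ 2. Then: (i) the global clustering coefficient C_n converges in probability to f(λ), i.e. for every ε > 0, P(|C_n − f(λ)| > ε) → 0 as n → ∞; (ii) f is decreasing on [1,4] and increasing on [4,∞); (iii) f(λ) < f(1) = 3/4 for all λ > 1. -/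

import Mathlib

open MeasureTheory Finset

noncomputable section

/-- The periodic distance on `[0,1]`: `d(u,v) = min(|u-v|, 1-|u-v|)`. -/
def pdist (u v : ℝ) : ℝ := min |u - v| (1 - |u - v|)

/-- The law of `(X_1, …, X_n)`: the product of `n` uniform measures on `[0,1]`. -/
def gbmMeasure (n : ℕ) : Measure (Fin n → ℝ) :=
  Measure.pi fun _ => volume.restrict (Set.Icc (0 : ℝ) 1)

/-- The adjacency matrix of the geometric block model `G_n(r_s, r_d)` with
communities `V₁ = {0,…,m-1}` and `V₂ = {m,…,n-1}`: `A i i = 0`, and for `i ≠ j`,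
`A i j = 1[d(X_i,X_j) ≤ r_s]` if `i, j` are in the same community and
`A i j = 1[d(X_i,X_j) ≤ r_d]` otherwise. -/
def gbmA (n m : ℕ) (rs rd : ℝ) (X : Fin n → ℝ) (i j : Fin n) : ℝ :=
  if i = j then 0
  else if ((i : ℕ) < m ↔ (j : ℕ) < m) then
    (if pdist (X i) (X j) ≤ rs then 1 else 0)
  else (if pdist (X i) (X j) ≤ rd then 1 else 0)

/-- Ordered triangle count `Σ_{i≠j≠k} A_ij A_jk A_ki`. -/
def triSum (n m : ℕ) (rs rd : ℝ) (X : Fin n → ℝ) : ℝ :=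
  ∑ i : Fin n, ∑ j : Fin n, ∑ k : Fin n,
    if i ≠ j ∧ i ≠ k ∧ j ≠ k then
      gbmA n m rs rd X i j * gbmA n m rs rd X j k * gbmA n m rs rd X k i
    else 0

/-- Ordered 2-path count `Σ_{i≠j≠k} A_ij A_ik`. -/
def pathSum (n m : ℕ) (rs rd : ℝ) (X : Fin n → ℝ) : ℝ :=
  ∑ i : Fin n, ∑ j : Fin n, ∑ k : Fin n,
    if i ≠ j ∧ i ≠ k ∧ j ≠ k then
      gbmA n m rs rd X i j * gbmA n m rs rd X i k
    else 0

/-- The global clustering coefficient `C_n = (Σ A_ij A_jk A_ki)/(Σ A_ij A_ik)`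
(by Lean's convention `x / 0 = 0`, it is `0` when the denominator vanishes). -/
def globalCC (n m : ℕ) (rs rd : ℝ) (X : Fin n → ℝ) : ℝ :=
  triSum n m rs rd X / pathSum n m rs rd X

/-- The limit function `f(λ)` of the global clustering coefficient of the
balanced GBM with `r_s = λ r_d`. -/
def ffun (l : ℝ) : ℝ :=
  if l < 2 then 3 * l / (1 + l) ^ 2 else 3 * (4 + l ^ 2) / (4 * (1 + l) ^ 2)

/-! ### Part 1: abstract second-moment machinery on product spaces -/

/-- Bounded measurable functions. -/
def BM {α : Type*} [MeasurableSpace α] (F : α → ℝ) : Prop :=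
  Measurable F ∧ ∃ C : ℝ, ∀ x, |F x| ≤ C

lemma BM.const {α : Type*} [MeasurableSpace α] (c : ℝ) : BM (fun _ : α => c) :=
  ⟨measurable_const, |c|, fun _ => le_rfl⟩

lemma BM.mul {α : Type*} [MeasurableSpace α] {F G : α → ℝ} (hF : BM F) (hG : BM G) :
    BM (fun x => F x * G x) := by
  obtain ⟨hF, C, hC⟩ := hF
  obtain ⟨hG, D, hD⟩ := hG
  refine ⟨hF.mul hG, C * D, fun x => ?_⟩
  rw [abs_mul]
  exact mul_le_mul (hC x) (hD x) (abs_nonneg _) ((abs_nonneg _).trans (hC x))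

lemma BM.add {α : Type*} [MeasurableSpace α] {F G : α → ℝ} (hF : BM F) (hG : BM G) :
    BM (fun x => F x + G x) := by
  obtain ⟨hF, C, hC⟩ := hF
  obtain ⟨hG, D, hD⟩ := hG
  exact ⟨hF.add hG, C + D, fun x => (abs_add_le _ _).trans (add_le_add (hC x) (hD x))⟩

lemma BM.sub {α : Type*} [MeasurableSpace α] {F G : α → ℝ} (hF : BM F) (hG : BM G) :
    BM (fun x => F x - G x) := by
  obtain ⟨hF, C, hC⟩ := hF
  obtain ⟨hG, D, hD⟩ := hG
  exact ⟨hF.sub hG, C + D, fun x => (abs_sub _ _).trans (add_le_add (hC x) (hD x))⟩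

lemma BM.abs {α : Type*} [MeasurableSpace α] {F : α → ℝ} (hF : BM F) :
    BM (fun x => |F x|) := by
  obtain ⟨hF, C, hC⟩ := hF
  exact ⟨hF.abs, C, fun x => by rw [abs_abs]; exact hC x⟩

lemma BM.sum {α κ : Type*} [MeasurableSpace α] (s : Finset κ) {F : κ → α → ℝ}
    (hF : ∀ k, BM (F k)) : BM (fun x => ∑ k ∈ s, F k x) := by
  choose C hC using fun k => (hF k).2
  refine ⟨Finset.measurable_sum s fun k _ => (hF k).1, ∑ k ∈ s, C k, fun x => ?_⟩
  exact (Finset.abs_sum_le_sum_abs _ _).trans (Finset.sum_le_sum fun k _ => hC k x)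

lemma BM.comp {α β : Type*} [MeasurableSpace α] [MeasurableSpace β] {F : β → ℝ} (hF : BM F)
    {g : α → β} (hg : Measurable g) : BM (fun x => F (g x)) :=
  ⟨hF.1.comp hg, hF.2.choose, fun _ => hF.2.choose_spec _⟩

lemma BM.integrable {α : Type*} [MeasurableSpace α] {F : α → ℝ} (hF : BM F)
    (μ : Measure α) [IsFiniteMeasure μ] : Integrable F μ := by
  obtain ⟨hF, C, hC⟩ := hF
  exact Integrable.of_bound hF.aestronglyMeasurable C (Filter.Eventually.of_forall hC)

lemma BM.integral_right {α β : Type*} [MeasurableSpace α] [MeasurableSpace β] {F : α × β → ℝ}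
    (hF : BM F) (ν : Measure β) [IsProbabilityMeasure ν] : BM (fun x => ∫ y, F (x, y) ∂ν) := by
  obtain ⟨hF, C, hC⟩ := hF
  refine ⟨(hF.stronglyMeasurable.integral_prod_right' (ν := ν)).measurable, C, fun x => ?_⟩
  have := norm_integral_le_of_norm_le_const (μ := ν) (f := fun y => F (x, y)) (C := C)
    (Filter.Eventually.of_forall fun y => hC (x, y))
  simpa using this

section Core

variable {ι : Type*} [Fintype ι] [DecidableEq ι]

/-- product measure -/
def piM (ι : Type*) [Fintype ι] (ν : Measure ℝ) : Measure (ι → ℝ) := Measure.pi fun _ => ν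

instance (ν : Measure ℝ) [IsProbabilityMeasure ν] : IsProbabilityMeasure (piM ι ν) := by
  unfold piM; infer_instance

lemma measurable_upd (k : ι) :
    Measurable (fun p : (ι → ℝ) × ℝ => Function.update p.1 k p.2) := by
  rw [measurable_pi_iff]
  intro i
  by_cases h : i = k
  · subst h; simpa using measurable_snd
  · simp only [Function.update_of_ne h]
    exact (measurable_pi_apply i).comp measurable_fst

lemma map_upd (ν : Measure ℝ) [IsProbabilityMeasure ν] (k : ι) :
    ((piM ι ν).prod ν).map (fun p => Function.update p.1 k p.2) = piM ι ν := by
  symm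
  unfold piM
  apply Measure.pi_eq
  intro s hs
  rw [Measure.map_apply (measurable_upd k) (MeasurableSet.univ_pi hs)]
  have : (fun p : (ι → ℝ) × ℝ => Function.update p.1 k p.2) ⁻¹' (Set.univ.pi s)
      = (Set.univ.pi (Function.update s k Set.univ)) ×ˢ (s k) := by
    ext ⟨X, t⟩
    simp only [Set.mem_preimage, Set.mem_pi, Set.mem_univ, true_imp_iff, Set.mem_prod]
    constructor
    · intro h
      refine ⟨fun i => ?_, by simpa using h k⟩
      by_cases hi : i = k
      · subst hi; simp
      · simpa [Function.update_of_ne hi] using h i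
    · rintro ⟨h, h'⟩ i
      by_cases hi : i = k
      · subst hi; simpa using h'
      · simpa [Function.update_of_ne hi] using h i
  rw [this, Measure.prod_prod, Measure.pi_pi,
    ← Finset.mul_prod_erase _ (fun i => ν (s i)) (Finset.mem_univ k),
    ← Finset.mul_prod_erase _ (fun i => ν (Function.update s k Set.univ i)) (Finset.mem_univ k)]
  simp only [Function.update_self, measure_univ, one_mul]
  rw [mul_comm]
  congr 1
  apply Finset.prod_congr rfl
  intro i hi
  rw [Function.update_of_ne (Finset.ne_of_mem_erase hi)]

lemma integral_upd (ν : Measure ℝ) [IsProbabilityMeasure ν] (k : ι) {F : (ι → ℝ) → ℝ}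
    (hF : BM F) :
    ∫ X, F X ∂(piM ι ν) = ∫ X, ∫ t, F (Function.update X k t) ∂ν ∂(piM ι ν) := by
  conv_lhs => rw [← map_upd ν k]
  rw [integral_map (measurable_upd k).aemeasurable hF.1.aestronglyMeasurable,
    integral_prod _ ((hF.comp (measurable_upd k)).integrable _)]

/-- If the average over coordinate `k` is pointwise bounded, so is the integral. -/
lemma integral_upd_le (ν : Measure ℝ) [IsProbabilityMeasure ν] (k : ι) {F G : (ι → ℝ) → ℝ}
    (hF : BM F) (hG : BM G) (h : ∀ X, ∫ t, F (Function.update X k t) ∂ν ≤ G X) :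
    ∫ X, F X ∂(piM ι ν) ≤ ∫ X, G X ∂(piM ι ν) := by
  rw [integral_upd ν k hF]
  apply integral_mono _ (hG.integrable _) h
  exact ((hF.comp (measurable_upd k)).integral_right ν).integrable _

lemma core_L1 (ν : Measure ℝ) [IsProbabilityMeasure ν] (K : Finset ι)
    (B : (ι → ℝ) → ℝ) (φ : ι → (ι → ℝ) → ℝ) (hB : BM B) (hφ : ∀ k, BM (φ k))
    (hB0 : ∀ X, 0 ≤ B X)
    (hBu : ∀ k ∈ K, ∀ X t, B (Function.update X k t) = B X)
    (hφu : ∀ k ∈ K, ∀ l ∈ K, l ≠ k → ∀ X t, φ l (Function.update X k t) = φ l X)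
    (hφ0 : ∀ k ∈ K, ∀ X, ∫ t, φ k (Function.update X k t) ∂ν = 0)
    (v β c : ℝ) (hv : ∀ k ∈ K, ∀ X, ∫ t, φ k (Function.update X k t) ^ 2 ∂ν ≤ v)
    (hv0 : 0 ≤ v) (hβ : ∫ X, B X ∂(piM ι ν) ≤ β) (hc : 0 < c) :
    ∫ X, |B X * ∑ k ∈ K, φ k X| ∂(piM ι ν)
      ≤ β * c / 2 + (Fintype.card ι : ℝ) * (v * β) / (2 * c) := by
  have hS : BM (fun X => ∑ k ∈ K, φ k X) := BM.sum K hφ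
  have hBS : BM (fun X => B X * ((∑ k ∈ K, φ k X) * ∑ k ∈ K, φ k X)) := hB.mul (hS.mul hS)
  have hkl : ∀ k l, BM (fun X => B X * (φ k X * φ l X)) := fun k l =>
    hB.mul ((hφ k).mul (hφ l))
  have hβ0 : 0 ≤ β := (integral_nonneg hB0).trans hβ
  -- second moment
  have h2 : ∫ X, B X * ((∑ k ∈ K, φ k X) * ∑ k ∈ K, φ k X) ∂(piM ι ν)
      ≤ (Fintype.card ι : ℝ) * (v * β) := by
    have e : ∀ X, B X * ((∑ k ∈ K, φ k X) * ∑ k ∈ K, φ k X)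
        = ∑ k ∈ K, ∑ l ∈ K, B X * (φ k X * φ l X) := by
      intro X
      rw [Finset.sum_mul_sum, Finset.mul_sum]
      exact Finset.sum_congr rfl fun k _ => Finset.mul_sum _ _ _
    simp_rw [e]
    rw [integral_finsetSum _ (fun k _ => (BM.sum K (hkl k)).integrable _)]
    have h3 : ∀ k ∈ K, ∫ X, ∑ l ∈ K, B X * (φ k X * φ l X) ∂(piM ι ν) ≤ v * β := by
      intro k hk
      rw [integral_finsetSum _ (fun l _ => (hkl k l).integrable _)]
      rw [Finset.sum_eq_single_of_mem k hk]
      · calc ∫ X, B X * (φ k X * φ k X) ∂(piM ι ν) ≤ ∫ X, v * B X ∂(piM ι ν) := by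
              apply integral_upd_le ν k (hkl k k) ((BM.const v).mul hB)
              intro X
              simp_rw [hBu k hk]
              rw [integral_const_mul, mul_comm]
              apply mul_le_mul_of_nonneg_right _ (hB0 X)
              have := hv k hk X
              simpa [pow_two] using this
          _ ≤ v * β := by
              rw [integral_const_mul]
              exact mul_le_mul_of_nonneg_left hβ hv0
      · intro l hl hlk
        rw [integral_upd ν k (hkl k l)]
        simp_rw [hBu k hk, hφu k hk l hl hlk]
        have : ∀ X : ι → ℝ, ∫ t, B X * (φ k (Function.update X k t) * φ l X) ∂ν = 0 := by
          intro X
          rw [integral_const_mul, integral_mul_const, hφ0 k hk X]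
          simp
        simp [this]
    calc ∑ k ∈ K, ∫ X, ∑ l ∈ K, B X * (φ k X * φ l X) ∂(piM ι ν)
        ≤ ∑ k ∈ K, v * β := Finset.sum_le_sum h3
      _ = (K.card : ℝ) * (v * β) := by simp
      _ ≤ _ := by
        apply mul_le_mul_of_nonneg_right _ (mul_nonneg hv0 hβ0)
        exact_mod_cast Finset.card_le_univ K
  calc ∫ X, |B X * ∑ k ∈ K, φ k X| ∂(piM ι ν)
      ≤ ∫ X, ((c / 2) * B X
          + (1 / (2 * c)) * (B X * ((∑ k ∈ K, φ k X) * ∑ k ∈ K, φ k X))) ∂(piM ι ν) := by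
        apply integral_mono ((hB.mul hS).abs.integrable _)
          ((((BM.const (c / 2)).mul hB).add ((BM.const (1 / (2 * c))).mul hBS)).integrable _)
        intro X
        simp only
        set S := ∑ k ∈ K, φ k X
        rw [abs_mul, abs_of_nonneg (hB0 X)]
        have : |S| ≤ c / 2 + 1 / (2 * c) * (S * S) := by
          have h1 : c / 2 + 1 / (2 * c) * (S * S) - |S| = (|S| - c) ^ 2 / (2 * c) := by
            rw [← abs_mul_abs_self S]; field_simp; ring
          have h2 : 0 ≤ (|S| - c) ^ 2 / (2 * c) := by positivity
          linarith
        calc B X * |S| ≤ B X * (c / 2 + 1 / (2 * c) * (S * S)) :=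
              mul_le_mul_of_nonneg_left this (hB0 X)
          _ = _ := by ring
    _ = (c / 2) * ∫ X, B X ∂(piM ι ν) + (1 / (2 * c)) *
          ∫ X, B X * ((∑ k ∈ K, φ k X) * ∑ k ∈ K, φ k X) ∂(piM ι ν) := by
        rw [integral_add (((BM.const (c / 2)).mul hB).integrable _)
          (((BM.const (1 / (2 * c))).mul hBS).integrable _), integral_const_mul,
          integral_const_mul]
    _ ≤ (c / 2) * β + (1 / (2 * c)) * ((Fintype.card ι : ℝ) * (v * β)) := by
        gcongr
    _ = _ := by ring

lemma integral_sub_mean_sq (ν : Measure ℝ) [IsProbabilityMeasure ν] {f : ℝ → ℝ} (hf : BM f)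
    (m : ℝ) (hm : ∫ t, f t ∂ν = m) : ∫ t, (f t - m) ^ 2 ∂ν ≤ ∫ t, f t * f t ∂ν := by
  have : ∀ t, (f t - m) ^ 2 = f t * f t - (2 * m) * f t + m ^ 2 := fun t => by ring
  simp_rw [this]
  rw [integral_add (((hf.mul hf).sub ((BM.const (2 * m)).mul hf)).integrable _)
    (integrable_const _), integral_sub ((hf.mul hf).integrable _)
    (((BM.const (2 * m)).mul hf).integrable _), integral_const_mul, hm]
  simp
  nlinarith [sq_nonneg m]

lemma step_one (ν : Measure ℝ) [IsProbabilityMeasure ν] (i j : ι)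
    (hij : i ≠ j) (B : ℝ → ℝ → ℝ) (K : ι → ℝ → ℝ → ℝ → ℝ)
    (hB : BM (fun p : ℝ × ℝ => B p.1 p.2))
    (hK : ∀ k, BM (fun p : (ℝ × ℝ) × ℝ => K k p.1.1 p.1.2 p.2))
    (hB0 : ∀ x y, 0 ≤ B x y)
    (hK0 : ∀ k x y z, 0 ≤ K k x y z) (hK1 : ∀ k x y z, K k x y z ≤ 1)
    (q δ : ℝ) (hq : 0 < q) (hδ : 0 < δ)
    (hBq : ∀ x, ∫ y, B x y ∂ν ≤ q) (hKq : ∀ k x y, ∫ z, K k x y z ∂ν ≤ q) :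
    ∫ X, |B (X i) (X j) * ∑ k ∈ univ.filter (fun k => k ≠ i ∧ k ≠ j),
        (K k (X i) (X j) (X k) - ∫ z, K k (X i) (X j) z ∂ν)| ∂(piM ι ν)
      ≤ δ * (Fintype.card ι : ℝ) * q ^ 2 / 2 + q / (2 * δ) := by
  have hn : 0 < (Fintype.card ι : ℝ) := by
    exact_mod_cast Fintype.card_pos_iff.2 ⟨i⟩
  have hm1 : ∀ i : ι, Measurable (fun X : ι → ℝ => X i) := fun i => measurable_pi_apply i
  have hBX : BM (fun X : ι → ℝ => B (X i) (X j)) :=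
    hB.comp (g := fun X : ι → ℝ => (X i, X j)) ((hm1 i).prodMk (hm1 j))
  have hKz : ∀ k x y, BM (fun z => K k x y z) := fun k x y =>
    (hK k).comp (g := fun z => ((x, y), z)) (measurable_const.prodMk measurable_id)
  have key := core_L1 ν (univ.filter (fun k => k ≠ i ∧ k ≠ j))
    (fun X => B (X i) (X j)) (fun k X => K k (X i) (X j) (X k) - ∫ z, K k (X i) (X j) z ∂ν)
    hBX
    (fun k => by
      refine BM.sub ((hK k).comp (g := fun X : ι → ℝ => ((X i, X j), X k))
        (((hm1 i).prodMk (hm1 j)).prodMk (hm1 k))) ?_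
      exact ((hK k).integral_right ν).comp (g := fun X : ι → ℝ => (X i, X j))
        ((hm1 i).prodMk (hm1 j)))
    (fun X => hB0 _ _)
    (fun k hk X t => by
      simp only [mem_filter, mem_univ, true_and] at hk
      simp [Function.update_of_ne hk.1.symm, Function.update_of_ne hk.2.symm])
    (fun k hk l hl hlk X t => by
      simp only [mem_filter, mem_univ, true_and] at hk
      simp [Function.update_of_ne hk.1.symm, Function.update_of_ne hk.2.symm,
        Function.update_of_ne hlk])
    (fun k hk X => by
      simp only [mem_filter, mem_univ, true_and] at hk
      simp only [Function.update_of_ne hk.1.symm, Function.update_of_ne hk.2.symm,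
        Function.update_self]
      rw [integral_sub ((hKz _ _ _).integrable _) (integrable_const _)]
      simp)
    q q (δ * (Fintype.card ι : ℝ) * q)
    (fun k hk X => by
      simp only [mem_filter, mem_univ, true_and] at hk
      simp only [Function.update_of_ne hk.1.symm, Function.update_of_ne hk.2.symm,
        Function.update_self]
      refine (integral_sub_mean_sq ν (hKz k _ _) _ rfl).trans (le_trans ?_ (hKq k (X i) (X j)))
      apply integral_mono (((hKz _ _ _).mul (hKz _ _ _)).integrable _) ((hKz _ _ _).integrable _)
      intro t
      exact mul_le_of_le_one_left (hK0 _ _ _ _) (hK1 _ _ _ _))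
    hq.le
    (by
      refine (integral_upd_le ν j hBX (BM.const q) fun X => ?_).trans (by simp)
      simpa [Function.update_of_ne hij] using hBq (X i))
    (by positivity)
  refine key.trans (le_of_eq ?_)
  field_simp

lemma step_two (ν : Measure ℝ) [IsProbabilityMeasure ν] (i k : ι)
    (B : ι → ℝ → ℝ → ℝ) (p : ι → ℝ → ℝ → ℝ) (κ : ι → ℝ)
    (hB : ∀ j, BM (fun p : ℝ × ℝ => B j p.1 p.2))
    (hp : ∀ j, BM (fun s : ℝ × ℝ => p j s.1 s.2))
    (hB0 : ∀ j x y, 0 ≤ B j x y) (hB1 : ∀ j x y, B j x y ≤ 1)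
    (q δ : ℝ) (hq : 0 < q) (hδ : 0 < δ)
    (hp0 : ∀ j x y, 0 ≤ p j x y) (hpq : ∀ j x y, p j x y ≤ q)
    (hBq : ∀ j x, ∫ y, B j x y ∂ν ≤ q)
    (hκ : ∀ j x, ∫ y, B j x y * p j x y ∂ν = κ j) :
    ∫ X, |∑ j ∈ univ.filter (fun j => j ≠ i ∧ j ≠ k),
        (B j (X i) (X j) * p j (X i) (X j) - κ j)| ∂(piM ι ν)
      ≤ δ * (Fintype.card ι : ℝ) * q ^ 2 / 2 + q / (2 * δ) := by
  have hn : 0 < (Fintype.card ι : ℝ) := by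
    exact_mod_cast Fintype.card_pos_iff.2 ⟨i⟩
  have hm1 : ∀ i : ι, Measurable (fun X : ι → ℝ => X i) := fun i => measurable_pi_apply i
  have hBy : ∀ j x, BM (fun y => B j x y) := fun j x =>
    (hB j).comp (g := fun z => (x, z)) (measurable_const.prodMk measurable_id)
  have hpy : ∀ j x, BM (fun y => p j x y) := fun j x =>
    (hp j).comp (g := fun z => (x, z)) (measurable_const.prodMk measurable_id)
  have key := core_L1 ν (univ.filter (fun j => j ≠ i ∧ j ≠ k))
    (fun X => 1) (fun j X => B j (X i) (X j) * p j (X i) (X j) - κ j)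
    (BM.const 1)
    (fun j => by
      exact BM.sub (((hB j).mul (hp j)).comp (g := fun X : ι → ℝ => (X i, X j))
        ((hm1 i).prodMk (hm1 j))) (BM.const _))
    (fun X => zero_le_one)
    (fun k hk X t => rfl)
    (fun k hk l hl hlk X t => by
      simp only [mem_filter, mem_univ, true_and] at hk
      simp [Function.update_of_ne hk.1.symm, Function.update_of_ne hlk])
    (fun k hk X => by
      simp only [mem_filter, mem_univ, true_and] at hk
      simp only [Function.update_of_ne hk.1.symm, Function.update_self]
      rw [integral_sub (((hBy _ _).mul (hpy _ _)).integrable _) (integrable_const _), hκ]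
      simp)
    (q ^ 3) 1 (δ * (Fintype.card ι : ℝ) * q ^ 2)
    (fun k hk X => by
      simp only [mem_filter, mem_univ, true_and] at hk
      simp only [Function.update_of_ne hk.1.symm, Function.update_self]
      refine (integral_sub_mean_sq ν ((hBy k _).mul (hpy k _)) _ (hκ k (X i))).trans ?_
      calc _ ≤ ∫ t, q ^ 2 * B k (X i) t ∂ν := by
            apply integral_mono
              ((((hBy _ _).mul (hpy _ _)).mul ((hBy _ _).mul (hpy _ _))).integrable _)
              (((BM.const _).mul (hBy _ _)).integrable _)
            intro t
            simp only
            have h1 := hB0 k (X i) t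
            have h2 := hB1 k (X i) t
            have h3 := hp0 k (X i) t
            have h4 := hpq k (X i) t
            have h5 : p k (X i) t * p k (X i) t ≤ q ^ 2 := by nlinarith
            have h6 : B k (X i) t * B k (X i) t ≤ B k (X i) t := by nlinarith
            calc _ = (p k (X i) t * p k (X i) t) * (B k (X i) t * B k (X i) t) := by ring
              _ ≤ _ := mul_le_mul h5 h6 (by positivity) (by positivity)
        _ ≤ q ^ 2 * q := by
            rw [integral_const_mul]
            exact mul_le_mul_of_nonneg_left (hBq _ _) (by positivity)
        _ = q ^ 3 := by ring)
    (by positivity)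
    (by simp)
    (by positivity)
  simp only [one_mul] at key
  refine key.trans (le_of_eq ?_)
  field_simp

lemma core_triple (ν : Measure ℝ) [IsProbabilityMeasure ν]
    (B : ι → ι → ℝ → ℝ → ℝ) (K : ι → ι → ι → ℝ → ℝ → ℝ → ℝ) (κ : ι → ι → ι → ℝ)
    (hB : ∀ i j, BM (fun p : ℝ × ℝ => B i j p.1 p.2))
    (hK : ∀ i j k, BM (fun p : (ℝ × ℝ) × ℝ => K i j k p.1.1 p.1.2 p.2))
    (hB0 : ∀ i j x y, 0 ≤ B i j x y) (hB1 : ∀ i j x y, B i j x y ≤ 1)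
    (hK0 : ∀ i j k x y z, 0 ≤ K i j k x y z) (hK1 : ∀ i j k x y z, K i j k x y z ≤ 1)
    (q δ : ℝ) (hq : 0 < q) (hδ : 0 < δ)
    (hBq : ∀ i j x, ∫ y, B i j x y ∂ν ≤ q) (hKq : ∀ i j k x y, ∫ z, K i j k x y z ∂ν ≤ q)
    (hκ : ∀ i j k x, ∫ y, B i j x y * (∫ z, K i j k x y z ∂ν) ∂ν = κ i j k) :
    ∫ X, |∑ i, ∑ j, ∑ k, if i ≠ j ∧ i ≠ k ∧ j ≠ k then
        (B i j (X i) (X j) * K i j k (X i) (X j) (X k) - κ i j k) else 0| ∂(piM ι ν)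
      ≤ (Fintype.card ι : ℝ) ^ 2 * (δ * (Fintype.card ι : ℝ) * q ^ 2 + q / δ) := by
  set n : ℝ := (Fintype.card ι : ℝ) with hn
  have hm1 : ∀ i : ι, Measurable (fun X : ι → ℝ => X i) := fun i => measurable_pi_apply i
  let P : ι → ι → ι → ℝ → ℝ → ℝ := fun i j k x y => ∫ z, K i j k x y z ∂ν
  have hP : ∀ i j k, BM (fun p : ℝ × ℝ => P i j k p.1 p.2) := fun i j k =>
    (hK i j k).integral_right ν
  let U : ι → ι → (ι → ℝ) → ℝ := fun i j X => if i ≠ j then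
    B i j (X i) (X j) * ∑ k ∈ univ.filter (fun k => k ≠ i ∧ k ≠ j),
        (K i j k (X i) (X j) (X k) - P i j k (X i) (X j)) else 0
  let V : ι → ι → (ι → ℝ) → ℝ := fun i k X => if i ≠ k then
    ∑ j ∈ univ.filter (fun j => j ≠ i ∧ j ≠ k),
        (B i j (X i) (X j) * P i j k (X i) (X j) - κ i j k) else 0
  have hUb : ∀ i j, BM (U i j) := by
    intro i j
    by_cases h : i ≠ j
    · simp only [U, if_pos h]
      refine BM.mul ((hB i j).comp (g := fun X : ι → ℝ => (X i, X j)) ((hm1 i).prodMk (hm1 j)))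
        (BM.sum _ fun k => BM.sub ?_ ?_)
      · exact (hK i j k).comp (g := fun X : ι → ℝ => ((X i, X j), X k))
          (((hm1 i).prodMk (hm1 j)).prodMk (hm1 k))
      · exact (hP i j k).comp (g := fun X : ι → ℝ => (X i, X j)) ((hm1 i).prodMk (hm1 j))
    · simp only [U, if_neg h]; exact BM.const 0
  have hVb : ∀ i j, BM (V i j) := by
    intro i k
    by_cases h : i ≠ k
    · simp only [V, if_pos h]
      exact BM.sum _ fun j => BM.sub (((hB i j).mul (hP i j k)).comp
        (g := fun X : ι → ℝ => (X i, X j)) ((hm1 i).prodMk (hm1 j))) (BM.const _)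
    · simp only [V, if_neg h]; exact BM.const 0
  have hE0 : 0 ≤ δ * n * q ^ 2 / 2 + q / (2 * δ) := by positivity
  have hU : ∀ i j, ∫ X, |U i j X| ∂(piM ι ν) ≤ δ * n * q ^ 2 / 2 + q / (2 * δ) := by
    intro i j
    by_cases h : i ≠ j
    · simp only [U, if_pos h]
      exact step_one ν i j h (B i j) (K i j) (hB i j) (hK i j) (hB0 i j) (hK0 i j) (hK1 i j)
        q δ hq hδ (hBq i j) (hKq i j)
    · simp only [U, if_neg h]; simpa using hE0
  have hV : ∀ i j, ∫ X, |V i j X| ∂(piM ι ν) ≤ δ * n * q ^ 2 / 2 + q / (2 * δ) := by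
    intro i k
    by_cases h : i ≠ k
    · simp only [V, if_pos h]
      exact step_two ν i k (B i) (fun j => P i j k) (fun j => κ i j k) (hB i)
        (fun j => hP i j k) (hB0 i) (hB1 i) q δ hq hδ
        (fun j x y => integral_nonneg fun z => hK0 _ _ _ _ _ _)
        (fun j x y => hKq i j k x y) (hBq i) (fun j x => hκ i j k x)
    · simp only [V, if_neg h]; simpa using hE0
  have hdec : ∀ X : ι → ℝ, (∑ i, ∑ j, ∑ k, if i ≠ j ∧ i ≠ k ∧ j ≠ k then
        (B i j (X i) (X j) * K i j k (X i) (X j) (X k) - κ i j k) else 0)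
      = ∑ i, ∑ j, (U i j X + V i j X) := by
    intro X
    apply Finset.sum_congr rfl
    intro i _
    rw [Finset.sum_add_distrib]
    have hV' : ∑ k, V i k X = ∑ j, ∑ k, if i ≠ j ∧ i ≠ k ∧ j ≠ k then
        (B i j (X i) (X j) * P i j k (X i) (X j) - κ i j k) else 0 := by
      rw [Finset.sum_comm]
      apply Finset.sum_congr rfl
      intro k _
      simp only [V]
      split_ifs with h
      · rw [Finset.sum_filter]
        apply Finset.sum_congr rfl
        intro j _
        congr 1
        simp only [eq_iff_iff]; tauto
      · symm; apply Finset.sum_eq_zero; intro j _; rw [if_neg]; tauto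
    have hU' : ∑ j, U i j X = ∑ j, ∑ k, if i ≠ j ∧ i ≠ k ∧ j ≠ k then
        B i j (X i) (X j) * (K i j k (X i) (X j) (X k) - P i j k (X i) (X j)) else 0 := by
      apply Finset.sum_congr rfl
      intro j _
      simp only [U]
      split_ifs with h
      · rw [Finset.mul_sum, Finset.sum_filter]
        apply Finset.sum_congr rfl
        intro k _
        congr 1
        simp only [eq_iff_iff, ne_eq, @eq_comm _ k]; tauto
      · symm; apply Finset.sum_eq_zero; intro k _; rw [if_neg]; tauto
    rw [hU', hV', ← Finset.sum_add_distrib]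
    apply Finset.sum_congr rfl
    intro j _
    rw [← Finset.sum_add_distrib]
    apply Finset.sum_congr rfl
    intro k _
    split_ifs <;> ring
  simp_rw [hdec]
  calc ∫ X, |∑ i, ∑ j, (U i j X + V i j X)| ∂(piM ι ν)
      ≤ ∫ X, ∑ i, ∑ j, (|U i j X| + |V i j X|) ∂(piM ι ν) := by
        apply integral_mono
          ((BM.sum _ fun i => BM.sum _ fun j => (hUb i j).add (hVb i j)).abs.integrable _)
          ((BM.sum _ fun i => BM.sum _ fun j => (hUb i j).abs.add (hVb i j).abs).integrable _)
        intro X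
        refine (Finset.abs_sum_le_sum_abs _ _).trans (Finset.sum_le_sum fun i _ => ?_)
        refine (Finset.abs_sum_le_sum_abs _ _).trans (Finset.sum_le_sum fun j _ => ?_)
        exact abs_add_le _ _
    _ = ∑ i, ∑ j, (∫ X, |U i j X| ∂(piM ι ν) + ∫ X, |V i j X| ∂(piM ι ν)) := by
        rw [integral_finsetSum _ fun i _ =>
          (BM.sum _ fun j => (hUb i j).abs.add (hVb i j).abs).integrable _]
        apply Finset.sum_congr rfl
        intro i _
        rw [integral_finsetSum _ fun j _ => ((hUb i j).abs.add (hVb i j).abs).integrable _]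
        apply Finset.sum_congr rfl
        intro j _
        rw [integral_add ((hUb i j).abs.integrable _) ((hVb i j).abs.integrable _)]
    _ ≤ ∑ i : ι, ∑ j : ι, ((δ * n * q ^ 2 / 2 + q / (2 * δ)) + (δ * n * q ^ 2 / 2 + q / (2 * δ))) :=
        Finset.sum_le_sum fun i _ => Finset.sum_le_sum fun j _ => add_le_add (hU i j) (hV i j)
    _ = _ := by
        simp only [Finset.sum_const, Finset.card_univ, nsmul_eq_mul, ← hn]
        field_simp
        ring

end Core

/-! ### Part 3: the periodic distance and area computations -/

/-- uniform measure on `[0,1]` -/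
def nu0 : Measure ℝ := volume.restrict (Set.Icc (0 : ℝ) 1)

instance : IsProbabilityMeasure nu0 := ⟨by simp [nu0]⟩

/-- distance to the nearest integer -/
def psi (t : ℝ) : ℝ := |t - round t|

lemma psi_measurable : Measurable psi := by
  have : psi = fun t => min (Int.fract t) (1 - Int.fract t) := by
    ext t; exact abs_sub_round_eq_min t
  rw [this]
  exact measurable_fract.min (measurable_const.sub measurable_fract)

lemma psi_periodic (t : ℝ) : psi (t + 1) = psi t := by
  unfold psi
  rw [round_add_one]; push_cast; congr 1; ring

lemma psi_sub_one (t : ℝ) : psi (t - 1) = psi t := by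
  rw [← psi_periodic (t - 1)]; simp

lemma psi_eq_abs {t : ℝ} (h : |t| ≤ 1 / 2) : psi t = |t| := by
  rw [abs_le] at h
  rcases eq_or_lt_of_le h.2 with h2 | h2
  · subst h2
    unfold psi
    rw [abs_sub_round_eq_min, Int.fract_eq_self.2 ⟨by norm_num, by norm_num⟩]
    norm_num
  · unfold psi
    rw [round_eq_zero_iff.2 ⟨h.1, h2⟩]; simp

lemma psi_le (t : ℝ) : psi t ≤ 1 / 2 := abs_sub_round t

lemma pdist_eq_psi {x y : ℝ} (hx : x ∈ Set.Icc (0 : ℝ) 1) (hy : y ∈ Set.Icc (0 : ℝ) 1) :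
    pdist x y = psi (x - y) := by
  obtain ⟨hx0, hx1⟩ := hx
  obtain ⟨hy0, hy1⟩ := hy
  unfold pdist
  rcases le_total |x - y| (1 / 2) with h | h
  · rw [psi_eq_abs h, min_eq_left (by linarith)]
  · rw [min_eq_right (by linarith)]
    rcases le_total 0 (x - y) with h0 | h0
    · rw [abs_of_nonneg h0] at h ⊢
      rw [← psi_sub_one, psi_eq_abs]
      · rw [abs_of_nonpos (by linarith)]; ring
      · rw [abs_of_nonpos (by linarith)]; linarith
    · rw [abs_of_nonpos h0] at h ⊢
      rw [← psi_periodic, psi_eq_abs]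
      · rw [abs_of_nonneg (by linarith)]; ring
      · rw [abs_of_nonneg (by linarith)]; linarith

lemma pdist_comm (x y : ℝ) : pdist x y = pdist y x := by
  unfold pdist; rw [abs_sub_comm]

/-- indicator of `psi t ≤ a` -/
def ee (a t : ℝ) : ℝ := if psi t ≤ a then 1 else 0

lemma ee_nonneg (a t : ℝ) : 0 ≤ ee a t := by unfold ee; split_ifs <;> norm_num
lemma ee_le_one (a t : ℝ) : ee a t ≤ 1 := by unfold ee; split_ifs <;> norm_num
lemma ee_one (t : ℝ) : ee 1 t = 1 := by
  unfold ee; rw [if_pos]; linarith [psi_le t]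
lemma ee_periodic (a t : ℝ) : ee a (t + 1) = ee a t := by unfold ee; rw [psi_periodic]
lemma ee_sub_one (a t : ℝ) : ee a (t - 1) = ee a t := by unfold ee; rw [psi_sub_one]

lemma ee_BM (a : ℝ) : BM (ee a) := by
  refine ⟨Measurable.ite (measurableSet_le psi_measurable measurable_const) measurable_const
    measurable_const, 1, fun t => ?_⟩
  rw [abs_of_nonneg (ee_nonneg a t)]; exact ee_le_one a t

lemma int_shift (F : ℝ → ℝ) (hF : ∀ t, F (t + 1) = F t) (x : ℝ) :
    ∫ t, F (x - t) ∂nu0 = ∫ t in (-(1 / 2) : ℝ)..(1 / 2), F t := by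
  unfold nu0
  rw [integral_Icc_eq_integral_Ioc, ← intervalIntegral.integral_of_le zero_le_one,
    intervalIntegral.integral_comp_sub_left]
  have := Function.Periodic.intervalIntegral_add_eq (f := F) (T := 1) hF (x - 1) (-(1 / 2))
  convert this using 2 <;> ring

lemma ee_mul_int {a : ℝ} (ha0 : 0 ≤ a) (ha : a ≤ 1 / 4) (g : ℝ → ℝ) :
    ∫ u in (-(1 / 2) : ℝ)..(1 / 2), ee a u * g u = ∫ u in (-a)..a, g u := by
  rw [intervalIntegral.integral_of_le (by norm_num), intervalIntegral.integral_of_le (by linarith),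
    ← integral_Icc_eq_integral_Ioc (x := -a)]
  have h : ∀ u ∈ Set.Ioc (-(1 / 2) : ℝ) (1 / 2), ee a u * g u = (Set.Icc (-a) a).indicator g u := by
    rintro u ⟨h1, h2⟩
    unfold ee Set.indicator
    rw [psi_eq_abs (abs_le.2 ⟨h1.le, h2⟩)]
    simp only [abs_le, Set.mem_Icc]
    split_ifs <;> simp
  rw [setIntegral_congr_fun measurableSet_Ioc h, setIntegral_indicator measurableSet_Icc]
  congr 2
  apply Set.inter_eq_right.2
  rintro u ⟨h1, h2⟩
  constructor <;> linarith

/-- measure of common neighbourhoods -/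
def Qf (b c u : ℝ) : ℝ := ∫ z in (-(1 / 2) : ℝ)..(1 / 2), ee b z * ee c (z - u)

/-- triangle density -/
def kap (a b c : ℝ) : ℝ := ∫ u in (-(1 / 2) : ℝ)..(1 / 2), ee a u * Qf b c u

lemma int_K (b c x y : ℝ) : ∫ z, ee b (x - z) * ee c (y - z) ∂nu0 = Qf b c (x - y) := by
  rw [Qf, ← int_shift (fun z => ee b z * ee c (z - (x - y))) _ x]
  · congr 1; ext z; congr 2; ring
  · intro t
    rw [ee_periodic, show t + 1 - (x - y) = (t - (x - y)) + 1 by ring, ee_periodic]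

lemma Qf_periodic (b c u : ℝ) : Qf b c (u + 1) = Qf b c u := by
  unfold Qf
  congr 1; ext z
  rw [show z - (u + 1) = z - u - 1 by ring, ee_sub_one]

lemma int_BK (a b c x : ℝ) :
    ∫ y, ee a (x - y) * (∫ z, ee b (x - z) * ee c (y - z) ∂nu0) ∂nu0 = kap a b c := by
  simp_rw [int_K]
  rw [kap, ← int_shift (fun u => ee a u * Qf b c u) _ x]
  intro t
  rw [ee_periodic, Qf_periodic]

lemma int_B {a : ℝ} (ha0 : 0 ≤ a) (ha : a ≤ 1 / 4) (x : ℝ) :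
    ∫ y, ee a (x - y) ∂nu0 = 2 * a := by
  rw [int_shift (ee a) (ee_periodic a) x]
  have := ee_mul_int ha0 ha (fun _ => 1)
  simp only [mul_one] at this
  rw [this]; simp; ring

lemma Qf_one {b : ℝ} (hb0 : 0 ≤ b) (hb : b ≤ 1 / 4) (u : ℝ) : Qf b 1 u = 2 * b := by
  unfold Qf
  rw [ee_mul_int hb0 hb]
  simp [ee_one]; ring

lemma kap_one {a b : ℝ} (ha0 : 0 ≤ a) (ha : a ≤ 1 / 4) (hb0 : 0 ≤ b) (hb : b ≤ 1 / 4) :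
    kap a b 1 = 4 * a * b := by
  unfold kap
  rw [ee_mul_int ha0 ha]
  simp [Qf_one hb0 hb]; ring

lemma Qf_eq {b c u : ℝ} (hb0 : 0 ≤ b) (hb : b ≤ 1 / 4)
    (hu : |u| ≤ 1 / 4) :
    Qf b c u = max 0 (min b (u + c) - max (-b) (u - c)) := by
  unfold Qf
  rw [ee_mul_int hb0 hb, intervalIntegral.integral_of_le (by linarith),
    ← integral_Icc_eq_integral_Ioc]
  rw [abs_le] at hu
  have h : ∀ z ∈ Set.Icc (-b) b, ee c (z - u)
      = (Set.Icc (u - c) (u + c)).indicator (fun _ => (1 : ℝ)) z := by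
    rintro z ⟨h1, h2⟩
    unfold ee Set.indicator
    rw [psi_eq_abs (abs_le.2 ⟨by linarith, by linarith⟩)]
    simp only [abs_le, Set.mem_Icc]
    congr 1
    simp only [eq_iff_iff]
    constructor <;> rintro ⟨h3, h4⟩ <;> constructor <;> linarith
  rw [setIntegral_congr_fun measurableSet_Icc h, setIntegral_indicator measurableSet_Icc,
    Set.Icc_inter_Icc]
  simp [Measure.real, ENNReal.toReal_ofReal', max_comm]

lemma kap_eq {a b c : ℝ} (ha0 : 0 ≤ a) (ha : a ≤ 1 / 4) (hb0 : 0 ≤ b) (hb : b ≤ 1 / 4) :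
    kap a b c = ∫ u in (-a)..a, max 0 (min b (u + c) - max (-b) (u - c)) := by
  unfold kap
  rw [ee_mul_int ha0 ha]
  apply intervalIntegral.integral_congr
  intro u hu
  rw [Set.uIcc_of_le (by linarith)] at hu
  exact Qf_eq hb0 hb (abs_le.2 ⟨by linarith [hu.1], by linarith [hu.2]⟩)

lemma even_int (a : ℝ) (g : ℝ → ℝ) (hg : Continuous g) :
    ∫ u in (-a)..a, g |u| = 2 * ∫ u in (0 : ℝ)..a, g |u| := by
  have hc : Continuous fun u => g |u| := hg.comp continuous_abs
  rw [← intervalIntegral.integral_add_adjacent_intervals (hc.intervalIntegrable (-a) 0)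
    (hc.intervalIntegrable 0 a)]
  have := intervalIntegral.integral_comp_neg (a := 0) (b := a) (fun u => g |u|)
  simp only [abs_neg, neg_zero] at this
  rw [← this]; ring

lemma lin_int (α β p q : ℝ) (hpq : p ≤ q) (g : ℝ → ℝ)
    (hg : ∀ u, p ≤ u → u ≤ q → g u = α + β * u) :
    ∫ u in p..q, g u = α * (q - p) + β * (q ^ 2 - p ^ 2) / 2 := by
  have : ∫ u in p..q, g u = ∫ u in p..q, (α + β * u) := by
    apply intervalIntegral.integral_congr
    intro u hu
    rw [Set.uIcc_of_le hpq] at hu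
    exact hg u hu.1 hu.2
  rw [this, intervalIntegral.integral_add (by simp) (Continuous.intervalIntegrable (by fun_prop) _ _),
    intervalIntegral.integral_const_mul, integral_id]
  simp; ring

/-- mixed triangle density -/
def mm (s d : ℝ) : ℝ := if s < 2 * d then 4 * d * s - s ^ 2 else 4 * d ^ 2

lemma kap_same {s : ℝ} (hs0 : 0 ≤ s) (hs : s ≤ 1 / 4) : kap s s s = 3 * s ^ 2 := by
  rw [kap_eq hs0 hs hs0 hs]
  have : ∀ u, max 0 (min s (u + s) - max (-s) (u - s)) = (fun v => max 0 (2 * s - v)) |u| := by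
    intro u; grind
  simp_rw [this]
  rw [even_int _ (fun v => max 0 (2 * s - v)) (by fun_prop), lin_int (2 * s) (-1) 0 s hs0]
  · ring
  · intro u h0 h1; rw [abs_of_nonneg h0, max_eq_right (by linarith)]; ring

lemma kap_sdd {s d : ℝ} (hd0 : 0 ≤ d) (hds : d ≤ s) (hs : s ≤ 1 / 4) : kap s d d = mm s d := by
  rw [kap_eq (by linarith) hs hd0 (by linarith)]
  have : ∀ u, max 0 (min d (u + d) - max (-d) (u - d)) = (fun v => max 0 (2 * d - v)) |u| := by
    intro u; grind
  simp_rw [this]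
  have hc : Continuous fun v : ℝ => max 0 (2 * d - v) := by fun_prop
  rw [even_int _ (fun v => max 0 (2 * d - v)) hc]
  unfold mm
  split_ifs with h
  · rw [lin_int (2 * d) (-1) 0 s (by linarith)]
    · ring
    · intro u h0 h1; rw [abs_of_nonneg h0, max_eq_right (by linarith)]; ring
  · have hc' : Continuous fun u : ℝ => max 0 (2 * d - |u|) := hc.comp continuous_abs
    rw [← intervalIntegral.integral_add_adjacent_intervals (hc'.intervalIntegrable 0 (2 * d))
      (hc'.intervalIntegrable (2 * d) s), lin_int (2 * d) (-1) 0 (2 * d) (by linarith),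
      lin_int 0 0 (2 * d) s (by linarith)]
    · ring
    · intro u h0 h1; rw [abs_of_nonneg (by linarith), max_eq_left (by linarith)]; ring
    · intro u h0 h1; rw [abs_of_nonneg h0, max_eq_right (by linarith)]; ring

lemma mix_int {s d : ℝ} (hd0 : 0 ≤ d) (hds : d ≤ s) :
    ∫ u in (-d)..d, min (2 * d) (s + d - |u|) = mm s d := by
  have hc : Continuous fun v : ℝ => min (2 * d) (s + d - v) := by fun_prop
  rw [even_int _ (fun v => min (2 * d) (s + d - v)) hc]
  unfold mm
  split_ifs with h
  · have hc' : Continuous fun u : ℝ => min (2 * d) (s + d - |u|) := hc.comp continuous_abs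
    rw [← intervalIntegral.integral_add_adjacent_intervals (hc'.intervalIntegrable 0 (s - d))
      (hc'.intervalIntegrable (s - d) d), lin_int (2 * d) 0 0 (s - d) (by linarith),
      lin_int (s + d) (-1) (s - d) d (by linarith)]
    · ring
    · intro u h0 h1; rw [abs_of_nonneg (by linarith), min_eq_right (by linarith)]; ring
    · intro u h0 h1; rw [abs_of_nonneg h0, min_eq_left (by linarith)]; ring
  · rw [lin_int (2 * d) 0 0 d (by linarith)]
    · ring
    · intro u h0 h1; rw [abs_of_nonneg h0, min_eq_left (by linarith)]; ring

lemma kap_dsd {s d : ℝ} (hd0 : 0 ≤ d) (hds : d ≤ s) (hs : s ≤ 1 / 4) : kap d s d = mm s d := by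
  rw [kap_eq hd0 (by linarith) (by linarith) hs, ← mix_int hd0 hds]
  apply intervalIntegral.integral_congr
  intro u hu
  rw [Set.uIcc_of_le (by linarith)] at hu
  obtain ⟨h1, h2⟩ := hu
  simp only
  grind

lemma kap_dds {s d : ℝ} (hd0 : 0 ≤ d) (hds : d ≤ s) (hs : s ≤ 1 / 4) : kap d d s = mm s d := by
  rw [kap_eq hd0 (by linarith) hd0 (by linarith), ← mix_int hd0 hds]
  apply intervalIntegral.integral_congr
  intro u hu
  rw [Set.uIcc_of_le (by linarith)] at hu
  obtain ⟨h1, h2⟩ := hu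
  simp only
  grind

lemma Qf_nonneg (b c u : ℝ) : 0 ≤ Qf b c u := by
  apply intervalIntegral.integral_nonneg (by norm_num)
  intro z _
  exact mul_nonneg (ee_nonneg _ _) (ee_nonneg _ _)


/-! ### Part 4: the geometric block model -/

lemma ee_comp_BM {α : Type*} [MeasurableSpace α] (a : ℝ) {g : α → ℝ} (hg : Measurable g) :
    BM (fun x => ee a (g x)) := (ee_BM a).comp hg

lemma K_BM (b c : ℝ) :
    BM (fun p : (ℝ × ℝ) × ℝ => ee b (p.1.1 - p.2) * ee c (p.1.2 - p.2)) :=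
  (ee_comp_BM b (by fun_prop)).mul (ee_comp_BM c (by fun_prop))

lemma int_K_le {b r : ℝ} (hb0 : 0 ≤ b) (hbr : b ≤ r) (hr : r ≤ 1 / 4) (c x y : ℝ) :
    ∫ z, ee b (x - z) * ee c (y - z) ∂nu0 ≤ 2 * r := by
  calc _ ≤ ∫ z, ee b (x - z) ∂nu0 := by
        apply integral_mono
          (((ee_comp_BM b (by fun_prop)).mul (ee_comp_BM c (by fun_prop))).integrable _)
          ((ee_comp_BM b (by fun_prop)).integrable _)
        intro z
        exact mul_le_of_le_one_right (ee_nonneg _ _) (ee_le_one _ _)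
    _ = 2 * b := int_B hb0 (hbr.trans hr) x
    _ ≤ _ := by linarith

lemma kap_nonneg (a b c : ℝ) : 0 ≤ kap a b c := by
  apply intervalIntegral.integral_nonneg (by norm_num)
  intro z _
  exact mul_nonneg (ee_nonneg _ _) (Qf_nonneg _ _ _)

lemma kap_le {a b c r : ℝ} (ha0 : 0 ≤ a) (har : a ≤ r) (hb0 : 0 ≤ b) (hbr : b ≤ r)
    (hr : r ≤ 1 / 4) : kap a b c ≤ 4 * r ^ 2 := by
  rw [← int_BK a b c 0]
  have hr0 : 0 ≤ r := ha0.trans har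
  have h1 : BM (fun y : ℝ => ∫ z, ee b (0 - z) * ee c (y - z) ∂nu0) :=
    ((K_BM b c).integral_right nu0).comp (g := fun y : ℝ => ((0 : ℝ), y)) (by fun_prop)
  have h2 : BM (fun y : ℝ => ee a (0 - y)) := ee_comp_BM a (by fun_prop)
  calc _ ≤ ∫ y, ee a (0 - y) * (2 * r) ∂nu0 := by
        apply integral_mono ((h2.mul h1).integrable _) ((h2.mul (BM.const _)).integrable _)
        intro y
        exact mul_le_mul_of_nonneg_left (int_K_le hb0 hbr hr c 0 y) (ee_nonneg _ _)
    _ = 2 * a * (2 * r) := by rw [integral_mul_const, int_B ha0 (har.trans hr)]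
    _ ≤ _ := by nlinarith

/-- smooth version of triple sums -/
def tripS {n : ℕ} (a b c : Fin n → Fin n → ℝ) (X : Fin n → ℝ) : ℝ :=
  ∑ i, ∑ j, ∑ k, if i ≠ j ∧ i ≠ k ∧ j ≠ k then
    ee (a i j) (X i - X j) * (ee (b i k) (X i - X k) * ee (c j k) (X j - X k)) else 0

lemma tripS_BM {n : ℕ} (a b c : Fin n → Fin n → ℝ) : BM (tripS a b c) := by
  unfold tripS
  refine BM.sum _ fun i => BM.sum _ fun j => BM.sum _ fun k => ?_
  split_ifs
  · exact (ee_comp_BM _ (by fun_prop)).mul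
      ((ee_comp_BM _ (by fun_prop)).mul (ee_comp_BM _ (by fun_prop)))
  · exact BM.const 0

/-- mean, diagonal terms included -/
def tripM {n : ℕ} (a b c : Fin n → Fin n → ℝ) : ℝ :=
  ∑ i, ∑ j, ∑ k, kap (a i j) (b i k) (c j k)

lemma tripS_conc {n : ℕ} (a b c : Fin n → Fin n → ℝ) (r δ : ℝ) (hr0 : 0 < r) (hr : r ≤ 1 / 4)
    (ha0 : ∀ i j, 0 ≤ a i j) (har : ∀ i j, a i j ≤ r)
    (hb0 : ∀ i j, 0 ≤ b i j) (hbr : ∀ i j, b i j ≤ r) (hδ : 0 < δ) :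
    ∫ X, |tripS a b c X - tripM a b c| ∂(piM (Fin n) nu0)
      ≤ (n : ℝ) ^ 2 * (δ * n * (2 * r) ^ 2 + 2 * r / δ) + 12 * (n : ℝ) ^ 2 * r ^ 2 := by
  have key := core_triple (ι := Fin n) nu0
    (fun i j x y => ee (a i j) (x - y))
    (fun i j k x y z => ee (b i k) (x - z) * ee (c j k) (y - z))
    (fun i j k => kap (a i j) (b i k) (c j k))
    (fun i j => ee_comp_BM _ (by fun_prop))
    (fun i j k => K_BM _ _)
    (fun i j x y => ee_nonneg _ _) (fun i j x y => ee_le_one _ _)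
    (fun i j k x y z => mul_nonneg (ee_nonneg _ _) (ee_nonneg _ _))
    (fun i j k x y z => mul_le_one₀ (ee_le_one _ _) (ee_nonneg _ _) (ee_le_one _ _))
    (2 * r) δ (by linarith) hδ
    (fun i j x => by rw [int_B (ha0 i j) ((har i j).trans hr)]; linarith [har i j])
    (fun i j k x y => int_K_le (hb0 i k) (hbr i k) hr _ x y)
    (fun i j k x => int_BK _ _ _ _)
  rw [Fintype.card_fin] at key
  set D : (Fin n → ℝ) → ℝ := fun X => ∑ i, ∑ j, ∑ k, if i ≠ j ∧ i ≠ k ∧ j ≠ k then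
        (ee (a i j) (X i - X j) * (ee (b i k) (X i - X k) * ee (c j k) (X j - X k))
          - kap (a i j) (b i k) (c j k)) else 0 with hD
  set R : ℝ := ∑ i : Fin n, ∑ j : Fin n, ∑ k : Fin n, if i ≠ j ∧ i ≠ k ∧ j ≠ k then 0 else
    kap (a i j) (b i k) (c j k) with hR
  have hdec : ∀ X, tripS a b c X - tripM a b c = D X - R := by
    intro X
    simp only [tripS, tripM, hD, hR, ← Finset.sum_sub_distrib]
    refine Finset.sum_congr rfl fun i _ => Finset.sum_congr rfl fun j _ =>
      Finset.sum_congr rfl fun k _ => ?_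
    split_ifs <;> ring
  have hDBM : BM D := by
    refine BM.sum _ fun i => BM.sum _ fun j => BM.sum _ fun k => ?_
    split_ifs
    · exact ((ee_comp_BM _ (by fun_prop)).mul
        ((ee_comp_BM _ (by fun_prop)).mul (ee_comp_BM _ (by fun_prop)))).sub (BM.const _)
    · exact BM.const 0
  have hR0 : 0 ≤ R := by
    refine Finset.sum_nonneg fun i _ => Finset.sum_nonneg fun j _ =>
      Finset.sum_nonneg fun k _ => ?_
    split_ifs
    · exact le_rfl
    · exact kap_nonneg _ _ _
  have hRle : R ≤ 12 * (n : ℝ) ^ 2 * r ^ 2 := by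
    calc R ≤ ∑ i : Fin n, ∑ j : Fin n, ∑ k : Fin n,
          ((if i = j then 4 * r ^ 2 else 0) + (if i = k then 4 * r ^ 2 else 0)
            + (if j = k then 4 * r ^ 2 else 0)) := by
          refine Finset.sum_le_sum fun i _ => Finset.sum_le_sum fun j _ =>
            Finset.sum_le_sum fun k _ => ?_
          have h1 := kap_le (c := c j k) (ha0 i j) (har i j) (hb0 i k) (hbr i k) hr
          have h2 : 0 ≤ 4 * r ^ 2 := by positivity
          by_cases e1 : i = j <;> by_cases e2 : i = k <;> by_cases e3 : j = k <;>
            simp only [e1, e2, e3, ne_eq, not_true_eq_false, not_false_eq_true, and_true, and_self,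
              and_false, false_and, if_true, if_false] <;> first | linarith | skip
          all_goals (subst_vars; first | linarith | simp_all)
      _ = _ := by
          simp [Finset.sum_add_distrib]
          ring
  simp_rw [hdec]
  calc ∫ X, |D X - R| ∂(piM (Fin n) nu0) ≤ ∫ X, (|D X| + R) ∂(piM (Fin n) nu0) := by
        apply integral_mono ((hDBM.sub (BM.const R)).abs.integrable _)
          ((hDBM.abs.add (BM.const R)).integrable _)
        intro X
        refine (abs_sub _ _).trans ?_
        rw [abs_of_nonneg hR0]
    _ = ∫ X, |D X| ∂(piM (Fin n) nu0) + R := by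
        rw [integral_add (hDBM.abs.integrable _) (integrable_const _)]; simp
    _ ≤ _ := add_le_add key hRle

/-- radius of a pair -/
def ww {n : ℕ} (m : ℕ) (rs rd : ℝ) (i j : Fin n) : ℝ :=
  if ((i : ℕ) < m ↔ (j : ℕ) < m) then rs else rd

lemma gbmA_eq {n m : ℕ} (rs rd : ℝ) {X : Fin n → ℝ} (hX : ∀ i, X i ∈ Set.Icc (0 : ℝ) 1)
    {i j : Fin n} (hij : i ≠ j) : gbmA n m rs rd X i j = ee (ww m rs rd i j) (X i - X j) := by
  unfold gbmA ee ww
  rw [if_neg hij, ← pdist_eq_psi (hX i) (hX j)]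
  split_ifs <;> rfl

lemma gbmA_symm {n m : ℕ} (rs rd : ℝ) (X : Fin n → ℝ)
    (i j : Fin n) : gbmA n m rs rd X i j = gbmA n m rs rd X j i := by
  unfold gbmA
  rw [pdist_comm (X i) (X j)]
  simp only [eq_comm (a := i) (b := j), iff_comm (a := (i : ℕ) < m)]

lemma triSum_eq {n m : ℕ} (rs rd : ℝ) {X : Fin n → ℝ} (hX : ∀ i, X i ∈ Set.Icc (0 : ℝ) 1) :
    triSum n m rs rd X = tripS (ww m rs rd) (ww m rs rd) (ww m rs rd) X := by
  unfold triSum tripS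
  refine Finset.sum_congr rfl fun i _ => Finset.sum_congr rfl fun j _ =>
      Finset.sum_congr rfl fun k _ => ?_
  split_ifs with h
  · rw [gbmA_symm rs rd X k i, gbmA_eq rs rd hX h.1, gbmA_eq rs rd hX h.2.1,
      gbmA_eq rs rd hX h.2.2]; ring
  · rfl

lemma pathSum_eq {n m : ℕ} (rs rd : ℝ) {X : Fin n → ℝ} (hX : ∀ i, X i ∈ Set.Icc (0 : ℝ) 1) :
    pathSum n m rs rd X = tripS (ww m rs rd) (ww m rs rd) (fun _ _ => 1) X := by
  unfold pathSum tripS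
  refine Finset.sum_congr rfl fun i _ => Finset.sum_congr rfl fun j _ =>
      Finset.sum_congr rfl fun k _ => ?_
  split_ifs with h
  · rw [gbmA_eq rs rd hX h.1, gbmA_eq rs rd hX h.2.1, ee_one]; ring
  · rfl

lemma sum_half (k : ℕ) (F : Prop → ℝ) :
    ∑ i : Fin (2 * k), F ((i : ℕ) < k) = k * F True + k * F False := by
  rw [Fin.sum_univ_eq_sum_range (fun i => F (i < k)) (2 * k), two_mul, Finset.sum_range_add]
  have h1 : ∑ i ∈ range k, F (i < k) = ∑ i ∈ range k, F True :=
    Finset.sum_congr rfl fun i hi => by simp [Finset.mem_range.1 hi]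
  have h2 : ∑ i ∈ range k, F (k + i < k) = ∑ i ∈ range k, F False :=
    Finset.sum_congr rfl fun i hi => by simp
  rw [h1, h2]; simp

lemma tripM_tri (k : ℕ) {s d : ℝ} (hd0 : 0 ≤ d) (hds : d ≤ s) (hs : s ≤ 1 / 4) :
    tripM (n := 2 * k) (ww k s d) (ww k s d) (ww k s d)
      = (k : ℝ) ^ 3 * (6 * s ^ 2 + 6 * mm s d) := by
  classical
  let G : Prop → Prop → ℝ := fun p q => if (p ↔ q) then s else d
  have h : tripM (n := 2 * k) (ww k s d) (ww k s d) (ww k s d)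
      = ∑ i : Fin (2 * k), ∑ j : Fin (2 * k), ∑ l : Fin (2 * k),
        (fun p q t => kap (G p q) (G p t) (G q t)) ((i : ℕ) < k) ((j : ℕ) < k) ((l : ℕ) < k) := by
    unfold tripM
    refine Finset.sum_congr rfl fun i _ => Finset.sum_congr rfl fun j _ =>
      Finset.sum_congr rfl fun l _ => ?_
    simp only [ww, G]
    congr
  rw [h]
  have e1 : ∀ p q : Prop, ∑ l : Fin (2 * k), kap (G p q) (G p ((l : ℕ) < k)) (G q ((l : ℕ) < k))
      = k * kap (G p q) (G p True) (G q True) + k * kap (G p q) (G p False) (G q False) :=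
    fun p q => sum_half k (fun t => kap (G p q) (G p t) (G q t))
  simp only [e1]
  have e2 : ∀ p : Prop, ∑ j : Fin (2 * k), (k * kap (G p ((j : ℕ) < k)) (G p True) (G ((j : ℕ) < k) True)
      + k * kap (G p ((j : ℕ) < k)) (G p False) (G ((j : ℕ) < k) False)) = _ :=
    fun p => sum_half k (fun q => k * kap (G p q) (G p True) (G q True)
      + k * kap (G p q) (G p False) (G q False))
  simp only [e2]
  rw [sum_half k (fun p => k * (k * kap (G p True) (G p True) (G True True)
      + k * kap (G p True) (G p False) (G True False))
      + k * (k * kap (G p False) (G p True) (G False True)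
      + k * kap (G p False) (G p False) (G False False)))]
  simp only [G, iff_self, iff_true, iff_false, not_true_eq_false, not_false_eq_true, if_true,
    if_false, true_iff, kap_same (hd0.trans hds) hs, kap_sdd hd0 hds hs, kap_dsd hd0 hds hs,
    kap_dds hd0 hds hs]
  ring

lemma tripM_path (k : ℕ) {s d : ℝ} (hd0 : 0 ≤ d) (hds : d ≤ s) (hs : s ≤ 1 / 4) :
    tripM (n := 2 * k) (ww k s d) (ww k s d) (fun _ _ => 1)
      = (k : ℝ) ^ 3 * (8 * (s + d) ^ 2) := by
  classical
  let G : Prop → Prop → ℝ := fun p q => if (p ↔ q) then s else d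
  have hw0 : ∀ i j : Fin (2 * k), 0 ≤ ww k s d i j := by
    intro i j; unfold ww; split_ifs <;> linarith
  have hw1 : ∀ i j : Fin (2 * k), ww k s d i j ≤ 1 / 4 := by
    intro i j; unfold ww; split_ifs <;> linarith
  have e : ∀ p : Prop, ∑ l : Fin (2 * k), G p ((l : ℕ) < k) = k * G p True + k * G p False :=
    fun p => sum_half k (G p)
  have h : tripM (n := 2 * k) (ww k s d) (ww k s d) (fun _ _ => 1)
      = ∑ i : Fin (2 * k), 4 * ((∑ j : Fin (2 * k), G ((i : ℕ) < k) ((j : ℕ) < k)) *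
          ∑ l : Fin (2 * k), G ((i : ℕ) < k) ((l : ℕ) < k)) := by
    unfold tripM
    refine Finset.sum_congr rfl fun i _ => ?_
    rw [Finset.sum_mul_sum, Finset.mul_sum]
    refine Finset.sum_congr rfl fun j _ => ?_
    rw [Finset.mul_sum]
    refine Finset.sum_congr rfl fun l _ => ?_
    rw [kap_one (hw0 _ _) (hw1 _ _) (hw0 _ _) (hw1 _ _)]
    simp only [ww, G]
    split_ifs <;> ring
  rw [h]
  simp only [e]
  rw [sum_half k (fun p => 4 * ((k * G p True + k * G p False) * (k * G p True + k * G p False)))]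
  simp only [G, iff_self, iff_true, iff_false, not_true_eq_false, not_false_eq_true, if_true,
    if_false]
  ring

/-! ### Part 5: conclusion -/

lemma ffun_eq {lam s d : ℝ} (hlam : 1 ≤ lam) (hd : 0 < d) (hs : s = lam * d) :
    6 * s ^ 2 + 6 * mm s d = ffun lam * (8 * (s + d) ^ 2) := by
  subst hs
  unfold mm ffun
  have h1 : (1 + lam) ≠ 0 := by linarith
  by_cases h : lam < 2
  · rw [if_pos h, if_pos (by nlinarith)]
    field_simp
    ring
  · rw [if_neg h, if_neg (by nlinarith)]
    field_simp
    ring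

lemma ffun_one : ffun 1 = 3 / 4 := by
  unfold ffun; norm_num

lemma ffun_two_le {l : ℝ} (h : 2 ≤ l) : ffun l = 3 * (4 + l ^ 2) / (4 * (1 + l) ^ 2) := by
  unfold ffun; rw [if_neg (not_lt.2 h)]

lemma ffun_le_two {l : ℝ} (h : l ≤ 2) : ffun l = 3 * l / (1 + l) ^ 2 := by
  rcases eq_or_lt_of_le h with h | h
  · subst h; unfold ffun; norm_num
  · unfold ffun; rw [if_pos h]

lemma ffun_anti1 {x y : ℝ} (hx : 1 ≤ x) (hxy : x < y) (hy : y ≤ 2) : ffun y < ffun x := by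
  have hx0 : 0 < x := by linarith
  have hy0 : 0 < y := by linarith
  rw [ffun_le_two hy, ffun_le_two (hxy.le.trans hy), div_lt_div_iff₀ (by positivity) (by positivity)]
  have : 0 < (y - x) * (x * y - 1) := mul_pos (by linarith) (by nlinarith)
  nlinarith

lemma ffun_anti2 {x y : ℝ} (hx : 2 ≤ x) (hxy : x < y) (hy : y ≤ 4) : ffun y < ffun x := by
  have hx0 : 0 < x := by linarith
  have hy0 : 0 < y := by linarith
  rw [ffun_two_le hx, ffun_two_le (hx.trans hxy.le), div_lt_div_iff₀ (by positivity) (by positivity)]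
  have : 0 < (y - x) * (3 * (x + y) + 8 - 2 * x * y) := by
    apply mul_pos (by linarith)
    nlinarith [mul_nonneg (sub_nonneg.2 hx) (sub_nonneg.2 hy)]
  nlinarith

lemma ffun_mono {x y : ℝ} (hx : 4 ≤ x) (hxy : x < y) : ffun x < ffun y := by
  have hx0 : 0 < x := by linarith
  have hy0 : 0 < y := by linarith
  rw [ffun_two_le (by linarith), ffun_two_le (by linarith),
    div_lt_div_iff₀ (by positivity) (by positivity)]
  have : 0 < (y - x) * (2 * x * y - 3 * (x + y) - 8) := by
    apply mul_pos (by linarith)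
    nlinarith
  nlinarith

lemma ffun_anti : StrictAntiOn ffun (Set.Icc 1 4) := by
  rintro x ⟨hx1, hx4⟩ y ⟨hy1, hy4⟩ hxy
  rcases le_total y 2 with h | h
  · exact ffun_anti1 hx1 hxy h
  · rcases le_or_gt 2 x with h' | h'
    · exact ffun_anti2 h' hxy hy4
    · rcases eq_or_lt_of_le h with h | h
      · subst h; exact ffun_anti1 hx1 h' le_rfl
      · exact (ffun_anti2 le_rfl h hy4).trans (ffun_anti1 hx1 h' le_rfl)

lemma ffun_lt_one {l : ℝ} (hl : 1 < l) : ffun l < ffun 1 := by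
  rcases le_total l 2 with h | h
  · exact ffun_anti1 le_rfl hl h
  · rw [ffun_one, ffun_two_le h, div_lt_div_iff₀ (by positivity) (by positivity)]
    nlinarith

lemma ffun_le {l : ℝ} (hl : 1 ≤ l) : ffun l ≤ 1 := by
  rcases eq_or_lt_of_le hl with h | h
  · rw [← h, ffun_one]; norm_num
  · have := ffun_lt_one h; rw [ffun_one] at this; linarith

lemma ffun_nonneg {l : ℝ} (hl : 1 ≤ l) : 0 ≤ ffun l := by
  unfold ffun; split_ifs <;> positivity

lemma ratio_close {T P Pb f θ : ℝ} (hPb : 0 < Pb) (hf0 : 0 ≤ f) (hf1 : f ≤ 1)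
    (hθ : θ ≤ 1 / 2) (hT : |T - f * Pb| ≤ θ * Pb) (hP : |P - Pb| ≤ θ * Pb) :
    |T / P - f| ≤ 4 * θ := by
  rw [abs_le] at hT hP
  have hP2 : Pb / 2 ≤ P := by nlinarith
  have hP0 : 0 < P := by linarith
  have hθ0 : 0 ≤ θ * Pb := by linarith
  have hθ1 : 0 ≤ θ := nonneg_of_mul_nonneg_left hθ0 hPb
  have e : T / P - f = (T - f * P) / P := by field_simp
  rw [e, abs_div, abs_of_pos hP0, div_le_iff₀ hP0, abs_le]
  have h4 : 2 * (θ * Pb) ≤ 4 * θ * P := by nlinarith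
  constructor <;> nlinarith

lemma ae_cube (n : ℕ) : ∀ᵐ X ∂(piM (Fin n) nu0), ∀ i, X i ∈ Set.Icc (0 : ℝ) 1 := by
  rw [ae_all_iff]
  intro i
  have h : ∀ᵐ x ∂nu0, x ∈ Set.Icc (0 : ℝ) 1 := ae_restrict_mem measurableSet_Icc
  exact (Measure.tendsto_eval_ae_ae (μ := fun _ : Fin n => nu0) (i := i)).eventually h

lemma conc_markov {n : ℕ} (S : (Fin n → ℝ) → ℝ) (hS : BM S) (M E t : ℝ) (ht : 0 < t)
    (h : ∫ X, |S X - M| ∂(piM (Fin n) nu0) ≤ E) :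
    (piM (Fin n) nu0) {X | t ≤ |S X - M|} ≤ ENNReal.ofReal (E / t) := by
  have h1 := mul_meas_ge_le_integral_of_nonneg (μ := piM (Fin n) nu0) (f := fun X => |S X - M|)
    (Filter.Eventually.of_forall fun X => abs_nonneg _)
    ((hS.sub (BM.const M)).abs.integrable _) t
  rw [← ofReal_measureReal]
  apply ENNReal.ofReal_le_ofReal
  rw [le_div_iff₀ ht, mul_comm]
  exact h1.trans h

lemma prob_bound {lam : ℝ} (hlam : 1 ≤ lam) (k : ℕ) {s d : ℝ} (hrel : s = lam * d)
    (hpos : 0 < s) (hs4 : s ≤ 1 / 4) (y : ℝ) (hy : y = ((2 * k : ℕ) : ℝ) * s) (hy0 : 0 < y)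
    {ε θ : ℝ} (hθ0 : 0 < θ) (hθ : θ ≤ 1 / 2) (hθε : 4 * θ ≤ ε) :
    gbmMeasure (2 * k) {X | ε < |globalCC (2 * k) k s d X - ffun lam|}
      ≤ ENNReal.ofReal ((6 / Real.sqrt y + 3 / y) / θ)
        + ENNReal.ofReal ((6 / Real.sqrt y + 3 / y) / θ) := by
  have hd : 0 < d := by
    by_contra hd; push Not at hd; nlinarith
  have hds : d ≤ s := by nlinarith
  have hk : 0 < (k : ℝ) := by
    rcases Nat.eq_zero_or_pos k with h | h
    · subst h; simp at hy; linarith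
    · exact_mod_cast h
  push_cast at hy
  have hw0 : ∀ i j : Fin (2 * k), 0 ≤ ww k s d i j := by
    intro i j; unfold ww; split_ifs <;> linarith
  have hws : ∀ i j : Fin (2 * k), ww k s d i j ≤ s := by
    intro i j; unfold ww; split_ifs <;> linarith
  have hsy : 0 < Real.sqrt y := Real.sqrt_pos.2 hy0
  set η := 6 / Real.sqrt y + 3 / y with hη
  have hη0 : 0 ≤ η := by positivity
  set Pb : ℝ := (k : ℝ) ^ 3 * (8 * (s + d) ^ 2) with hPb
  have hPb0 : 0 < Pb := by positivity
  have hE : (((2 * k : ℕ) : ℝ)) ^ 2 * (1 / Real.sqrt y * ((2 * k : ℕ) : ℝ) * (2 * s) ^ 2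
      + 2 * s / (1 / Real.sqrt y)) + 12 * ((2 * k : ℕ) : ℝ) ^ 2 * s ^ 2 ≤ η * Pb := by
    have h1 : (((2 * k : ℕ) : ℝ)) ^ 2 * (1 / Real.sqrt y * ((2 * k : ℕ) : ℝ) * (2 * s) ^ 2
      + 2 * s / (1 / Real.sqrt y)) + 12 * ((2 * k : ℕ) : ℝ) ^ 2 * s ^ 2
      ≤ η * (8 * (k : ℝ) ^ 3 * s ^ 2) := by
      push_cast
      have e1 : Real.sqrt y * Real.sqrt y = y := Real.mul_self_sqrt hy0.le
      have e2 : 2 * s / (1 / Real.sqrt y) = 2 * s * (y / Real.sqrt y) := by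
        field_simp; nlinarith
      have e3 : η * (8 * (k : ℝ) ^ 3 * s ^ 2)
          = 48 * k ^ 3 * s ^ 2 / Real.sqrt y + 3 / y * (8 * (k : ℝ) ^ 3 * s ^ 2) := by
        rw [hη]; ring
      have e4 : 3 / y * (8 * (k : ℝ) ^ 3 * s ^ 2) = 12 * k ^ 2 * s := by
        rw [hy]; field_simp; ring
      rw [e2, e3, e4]
      have e5 : (2 * (k : ℝ)) ^ 2 * (1 / Real.sqrt y * (2 * k) * (2 * s) ^ 2
          + 2 * s * (y / Real.sqrt y)) = 48 * k ^ 3 * s ^ 2 / Real.sqrt y := by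
        have : y / Real.sqrt y = 2 * k * s * (1 / Real.sqrt y) := by rw [hy]; ring
        rw [this]; ring
      rw [e5]
      have : (k : ℝ) ^ 2 * s * (4 * s) ≤ (k : ℝ) ^ 2 * s * 1 :=
        mul_le_mul_of_nonneg_left (by linarith) (by positivity)
      nlinarith
    refine h1.trans (mul_le_mul_of_nonneg_left ?_ hη0)
    have : s ^ 2 ≤ (s + d) ^ 2 := by nlinarith
    rw [hPb]
    have hk3 : 0 < (k : ℝ) ^ 3 := by positivity
    nlinarith
  have hT := (tripS_conc (ww k s d) (ww k s d) (ww k s d) s (1 / Real.sqrt y) hpos hs4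
    hw0 hws hw0 hws (by positivity)).trans hE
  have hP := (tripS_conc (ww k s d) (ww k s d) (fun _ _ => 1) s (1 / Real.sqrt y) hpos hs4
    hw0 hws hw0 hws (by positivity)).trans hE
  rw [tripM_tri k hd.le hds hs4, ffun_eq hlam hd hrel] at hT
  rw [tripM_path k hd.le hds hs4, ← hPb] at hP
  have hTe : (k : ℝ) ^ 3 * (ffun lam * (8 * (s + d) ^ 2)) = ffun lam * Pb := by rw [hPb]; ring
  rw [hTe] at hT
  have mT := conc_markov _ (tripS_BM _ _ _) _ _ (θ * Pb) (by positivity) hT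
  have mP := conc_markov _ (tripS_BM _ _ _) _ _ (θ * Pb) (by positivity) hP
  have e : η * Pb / (θ * Pb) = η / θ := by field_simp
  rw [e] at mT mP
  refine le_trans ?_ ((measure_union_le _ _).trans (add_le_add mT mP))
  change (piM (Fin (2 * k)) nu0) _ ≤ _
  apply measure_mono_ae
  filter_upwards [ae_cube (2 * k)] with X hX hbad
  have hbad' : ε < |globalCC (2 * k) k s d X - ffun lam| := hbad
  by_contra hcon
  have hcon' : ¬ (θ * Pb ≤ |tripS (ww k s d) (ww k s d) (ww k s d) X - ffun lam * Pb| ∨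
    θ * Pb ≤ |tripS (ww k s d) (ww k s d) (fun _ _ => 1) X - Pb|) := hcon
  push Not at hcon'
  unfold globalCC at hbad'
  rw [triSum_eq s d hX, pathSum_eq s d hX] at hbad'
  have := ratio_close hPb0 (ffun_nonneg hlam) (ffun_le hlam) hθ hcon'.1.le hcon'.2.le
  linarith

/-- For the balanced GBM (`τ = 1/2`, `n = 2k` nodes) with `r_s = λ r_d`,
`λ ≥ 1` constant, and `n r_s → ∞`: (i) the global clustering coefficient
converges in probability to `f(λ)`; (ii) `f` is decreasing on `[1,4]` and
increasing on `[4,∞)`; (iii) `f(λ) < f(1) = 3/4` for all `λ > 1`. -/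
theorem globalCC_limit_balanced_lambda (lam : ℝ) (hlam : 1 ≤ lam)
    (rs rd : ℕ → ℝ) (hrel : ∀ k, rs k = lam * rd k)
    (hpos : ∀ k, 0 < rs k) (hs4 : ∀ k, rs k ≤ 1 / 4)
    (hdeg : Filter.Tendsto (fun k : ℕ => ((2 * k : ℕ) : ℝ) * rs k)
      Filter.atTop Filter.atTop) :
    (∀ ε : ℝ, 0 < ε →
      Filter.Tendsto
        (fun k => gbmMeasure (2 * k)
          {X | ε < |globalCC (2 * k) k (rs k) (rd k) X - ffun lam|})
        Filter.atTop (nhds 0)) ∧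
    StrictAntiOn ffun (Set.Icc 1 4) ∧
    StrictMonoOn ffun (Set.Ici 4) ∧
    (∀ l : ℝ, 1 < l → ffun l < ffun 1) ∧
    ffun 1 = 3 / 4 := by
  refine ⟨?_, ffun_anti, fun x hx y _ hxy => ffun_mono hx hxy, fun l hl => ffun_lt_one hl, ffun_one⟩
  intro ε hε
  set θ : ℝ := min (1 / 2) (ε / 4) with hθdef
  have hθ0 : 0 < θ := by positivity
  have hθ1 : θ ≤ 1 / 2 := min_le_left _ _
  have hθ2 : 4 * θ ≤ ε := by linarith [min_le_right (1 / 2 : ℝ) (ε / 4)]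
  have hlim : Filter.Tendsto (fun k : ℕ =>
      ENNReal.ofReal ((6 / Real.sqrt (((2 * k : ℕ) : ℝ) * rs k) + 3 / (((2 * k : ℕ) : ℝ) * rs k)) / θ)
      + ENNReal.ofReal
        ((6 / Real.sqrt (((2 * k : ℕ) : ℝ) * rs k) + 3 / (((2 * k : ℕ) : ℝ) * rs k)) / θ))
      Filter.atTop (nhds 0) := by
    have h1 : Filter.Tendsto (fun k : ℕ =>
        (6 / Real.sqrt (((2 * k : ℕ) : ℝ) * rs k) + 3 / (((2 * k : ℕ) : ℝ) * rs k)) / θ)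
        Filter.atTop (nhds ((0 + 0) / θ)) :=
      (((Real.tendsto_sqrt_atTop.comp hdeg).const_div_atTop 6).add
        (hdeg.const_div_atTop 3)).div_const θ
    have h2 := ENNReal.tendsto_ofReal h1
    have h3 := h2.add h2
    simpa using h3
  refine tendsto_of_tendsto_of_tendsto_of_le_of_le' tendsto_const_nhds hlim
    (Filter.Eventually.of_forall fun _ => bot_le) ?_
  filter_upwards [hdeg.eventually_gt_atTop 0] with k hk
  exact prob_bound hlam k (hrel k) (hpos k) (hs4 k) _ rfl hk hθ0 hθ1 hθ2
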